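/- Let R = F[[X_1,...,X_n]] be a power series ring over a field F, and let C, C' be two bounded chain complexes of finitely generated free R-modules. If an R-linear chain map f : C → C' becomes a quasi-isomorphism after tensoring with F = R/(X_1,...,X_n), then f is a quasi-isomorphism. -/

import Mathlib

open CategoryTheory MonoidalCategory


/-- Elementwise exactness of the mapping cone of `f`. -/
def ConeExact {R : Type} [CommRing R] {C C' : ChainComplex (ModuleCat.{0} R) ℤ} (f : C ⟶ C') : Prop :=
  ∀ i j k l : ℤ, j = i + 1 → k = j + 1 → l = k + 1 → ∀ (x : C.X j) (y : C'.X k),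
    (C.d j i).hom x = 0 → (f.f j).hom x = (C'.d k j).hom y →
    ∃ (u : C.X k) (v : C'.X l), (C.d k j).hom u = x ∧ (f.f k).hom u - (C'.d l k).hom v = y

lemma epi_elem {R : Type} [CommRing R] {C C' : ChainComplex (ModuleCat.{0} R) ℤ} (f : C ⟶ C')
    (i j k : ℤ) (hi : j + 1 = i) (hk : k + 1 = j) :
    Epi (HomologicalComplex.homologyMap f j) ↔ ∀ y : C'.X j, (C'.d j k).hom y = 0 →
      ∃ (x : C.X j) (w : C'.X i), (C.d j k).hom x = 0 ∧
        y = (f.f j).hom x + (C'.d i j).hom w := by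
  rw [HomologicalComplex.epi_homologyMap_iff_up_to_refinements f i j k
    ((ComplexShape.down ℤ).prev_eq' hi) ((ComplexShape.down ℤ).next_eq' hk)]
  constructor
  · intro h y hy
    obtain ⟨A', π, hπ, x, hx, w, hw⟩ := h (A := ModuleCat.of R R)
      (ModuleCat.ofHom (LinearMap.toSpanSingleton R _ y)) (by ext; simpa using hy)
    obtain ⟨a, ha⟩ := (ModuleCat.epi_iff_surjective π).1 hπ (1 : R)
    refine ⟨x.hom a, w.hom a, congr($hx a), ?_⟩
    have := congr($hw a)
    simpa [ha] using this
  · intro h A y hy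
    have h' : ∀ a : A, ∃ (x : C.X j) (w : C'.X i), (C.d j k).hom x = 0 ∧
        y.hom a = (f.f j).hom x + (C'.d i j).hom w := fun a => h (y.hom a) congr($hy a)
    choose x w hx hw using h'
    refine ⟨ModuleCat.of R (A →₀ R), ModuleCat.ofHom (Finsupp.linearCombination R id), ?_,
      ModuleCat.ofHom (Finsupp.linearCombination R x), ?_,
      ModuleCat.ofHom (Finsupp.linearCombination R w), ?_⟩
    · rw [ModuleCat.epi_iff_surjective]
      intro a
      exact ⟨Finsupp.single a 1, by simp⟩
    · apply ModuleCat.hom_ext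
      apply Finsupp.lhom_ext
      intro a b
      simp [hx]
    · apply ModuleCat.hom_ext
      apply Finsupp.lhom_ext
      intro a b
      have := congr(b • $(hw a))
      simpa using this

lemma mono_elem {R : Type} [CommRing R] {C C' : ChainComplex (ModuleCat.{0} R) ℤ} (f : C ⟶ C')
    (i j k : ℤ) (hi : j + 1 = i) (hk : k + 1 = j) :
    Mono (HomologicalComplex.homologyMap f j) ↔ ∀ (x : C.X j) (y : C'.X i), (C.d j k).hom x = 0 →
      (f.f j).hom x = (C'.d i j).hom y →
      ∃ (w : C.X i), x = (C.d i j).hom w := by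
  rw [HomologicalComplex.mono_homologyMap_iff_up_to_refinements f i j k
    ((ComplexShape.down ℤ).prev_eq' hi) ((ComplexShape.down ℤ).next_eq' hk)]
  constructor
  · intro h x y hx hxy
    obtain ⟨A', π, hπ, w, hw⟩ := h (A := ModuleCat.of R R)
      (ModuleCat.ofHom (LinearMap.toSpanSingleton R _ x)) (by ext; simpa using hx)
      (ModuleCat.ofHom (LinearMap.toSpanSingleton R _ y)) (by ext; simpa using hxy)
    obtain ⟨a, ha⟩ := (ModuleCat.epi_iff_surjective π).1 hπ (1 : R)
    refine ⟨w.hom a, ?_⟩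
    have := congr($hw a)
    simpa [ha] using this
  · intro h A x hx y hxy
    have h' : ∀ a : A, ∃ (w : C.X i), x.hom a = (C.d i j).hom w :=
      fun a => h (x.hom a) (y.hom a) congr($hx a) congr($hxy a)
    choose w hw using h'
    refine ⟨ModuleCat.of R (A →₀ R), ModuleCat.ofHom (Finsupp.linearCombination R id), ?_,
      ModuleCat.ofHom (Finsupp.linearCombination R w), ?_⟩
    · rw [ModuleCat.epi_iff_surjective]
      intro a
      exact ⟨Finsupp.single a 1, by simp⟩
    · apply ModuleCat.hom_ext
      apply Finsupp.lhom_ext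
      intro a b
      have h1 : x.hom (b • a) = (C.d i j).hom (b • w a) := by
        rw [map_smul, map_smul, hw]
      simp only [ModuleCat.hom_comp, ModuleCat.hom_ofHom, LinearMap.comp_apply,
        Finsupp.linearCombination_single, id]
      exact h1

lemma d_d_elem {R : Type} [CommRing R] (C : ChainComplex (ModuleCat.{0} R) ℤ) (i j k : ℤ)
    (x : C.X i) : (C.d j k).hom ((C.d i j).hom x) = 0 := congr($(C.d_comp_d i j k) x)

lemma comm_elem {R : Type} [CommRing R] {C C' : ChainComplex (ModuleCat.{0} R) ℤ} (f : C ⟶ C')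
    (i j : ℤ) (x : C.X i) : (C'.d i j).hom ((f.f i).hom x) = (f.f j).hom ((C.d i j).hom x) :=
  congr($(f.comm i j) x)

lemma quasiIso_iff_coneExact {R : Type} [CommRing R] {C C' : ChainComplex (ModuleCat.{0} R) ℤ}
    (f : C ⟶ C') : QuasiIso f ↔ ConeExact f := by
  constructor
  · intro h i j k l hj hk hl x y hx hxy
    have h1 : Mono (HomologicalComplex.homologyMap f j) := inferInstance
    have h2 : Epi (HomologicalComplex.homologyMap f k) := inferInstance
    rw [mono_elem f k j i (by omega) (by omega)] at h1
    rw [epi_elem f l k j (by omega) (by omega)] at h2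
    obtain ⟨u, hu⟩ := h1 x y hx hxy
    obtain ⟨u', v, hu', hv⟩ := h2 (y - (f.f k).hom u) (by
      rw [map_sub, comm_elem, ← hu, hxy, sub_self])
    refine ⟨u + u', -v, ?_, ?_⟩
    · rw [map_add, hu', ← hu, add_zero]
    · rw [map_add, map_neg, sub_neg_eq_add, add_assoc, ← hv]; abel
  · intro h
    rw [quasiIso_iff]
    intro j
    rw [quasiIsoAt_iff_isIso_homologyMap]
    have h1 : Mono (HomologicalComplex.homologyMap f j) := by
      rw [mono_elem f (j+1) j (j-1) (by omega) (by omega)]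
      intro x y hx hxy
      obtain ⟨u, v, hu, -⟩ := h (j-1) j (j+1) (j+1+1) (by omega) rfl rfl x y hx hxy
      exact ⟨u, hu.symm⟩
    have h2 : Epi (HomologicalComplex.homologyMap f j) := by
      rw [epi_elem f (j+1) j (j-1) (by omega) (by omega)]
      intro y hy
      obtain ⟨u, v, hu, hv⟩ := h (j-1-1) (j-1) j (j+1) (by omega) (by omega) rfl 0 y
        (map_zero _) (by rw [map_zero, hy])
      refine ⟨u, -v, hu, ?_⟩
      rw [map_neg, ← sub_eq_add_neg, hv]
    exact isIso_of_mono_of_epi _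

/-- Main algebraic step. -/
lemma exact_of_exact_mod {R : Type} [CommRing R] (I : Ideal R) (hI : I ≤ Ideal.jacobson ⊥)
    (K : ℤ → Type) [∀ n, AddCommGroup (K n)] [∀ n, Module R (K n)]
    [∀ n, Module.Projective R (K n)] [∀ n, Module.Finite R (K n)]
    (D : ∀ n, K (n + 1) →ₗ[R] K n) (hD : ∀ n x, D n (D (n + 1) x) = 0)
    (N : ℤ) (hN : ∀ n < N, Subsingleton (K n))
    (hmod : ∀ n z, D n z ∈ I • (⊤ : Submodule R (K n)) →
      ∃ w, D (n + 1) w - z ∈ I • (⊤ : Submodule R (K (n + 1)))) :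
    ∀ n z, D n z = 0 → ∃ w, D (n + 1) w = z := by
  -- a projection onto the cycles gives exactness
  have key : ∀ n, (∃ p : K (n + 1) →ₗ[R] K (n + 1), (∀ z, D n (p z) = 0) ∧
      ∀ z, D n z = 0 → p z = z) → ∀ z, D n z = 0 → ∃ w, D (n + 1) w = z := by
    rintro n ⟨p, hp, hp'⟩
    have hr : LinearMap.range p = LinearMap.ker (D n) := by
      ext z
      constructor
      · rintro ⟨z, rfl⟩; exact hp z
      · intro hz; exact ⟨z, hp' z hz⟩
    have hle : LinearMap.ker (D n) ≤ LinearMap.range (D (n + 1)) := by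
      apply Submodule.le_of_le_smul_of_le_jacobson_bot (I := I) _ hI
      · intro z hz
        obtain ⟨w, hw⟩ := hmod n z (by rw [LinearMap.mem_ker.1 hz]; exact zero_mem _)
        have h1 : p (D (n + 1) w - z) ∈ I • LinearMap.ker (D n) := by
          have := Submodule.mem_map_of_mem (f := p) hw
          rwa [Submodule.map_smul'', Submodule.map_top, hr] at this
        rw [map_sub, hp' z hz, hp' _ (hD n w)] at h1
        have : z = D (n + 1) w + -(D (n + 1) w - z) := by abel
        rw [this]
        exact Submodule.add_mem_sup ⟨w, rfl⟩ (neg_mem h1)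
      · rw [← hr]
        exact (LinearMap.range_eq_map p) ▸ (Module.Finite.fg_top.map p)
    intro z hz
    exact hle hz
  have step : ∀ n, (∃ p : K (n + 1) →ₗ[R] K (n + 1), (∀ z, D n (p z) = 0) ∧
      ∀ z, D n z = 0 → p z = z) → (∃ p : K (n + 1 + 1) →ₗ[R] K (n + 1 + 1),
      (∀ z, D (n + 1) (p z) = 0) ∧ ∀ z, D (n + 1) z = 0 → p z = z) := by
    intro n h
    have hex := key n h
    obtain ⟨p, hp, hp'⟩ := h
    let g : K (n + 1 + 1) →ₗ[R] LinearMap.ker (D n) := (D (n + 1)).codRestrict _ (hD n)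
    have hg : Function.Surjective g := by
      rintro ⟨z, hz⟩
      obtain ⟨w, hw⟩ := hex z hz
      exact ⟨w, Subtype.ext hw⟩
    have hproj : Module.Projective R (LinearMap.ker (D n)) :=
      Module.Projective.of_split (LinearMap.ker (D n)).subtype (p.codRestrict _ hp) (by
        ext z; exact hp' z.1 z.2)
    obtain ⟨s, hs⟩ := Module.projective_lifting_property g LinearMap.id hg
    have hs' : ∀ z, D (n + 1) (s z) = z := fun z => congr(($hs z : K (n + 1)))
    refine ⟨LinearMap.id - s ∘ₗ g, fun z => ?_, fun z hz => ?_⟩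
    · simp only [LinearMap.sub_apply, LinearMap.id_apply, LinearMap.comp_apply, map_sub, hs']
      exact sub_self _
    · have : g z = 0 := Subtype.ext hz
      simp [this]
  have all : ∀ n, (∃ p : K (n + 1) →ₗ[R] K (n + 1), (∀ z, D n (p z) = 0) ∧
      ∀ z, D n z = 0 → p z = z) := by
    intro n
    by_cases hn : n + 1 < N
    · have := hN _ hn
      exact ⟨0, fun z => by simp, fun z _ => Subsingleton.elim _ _⟩
    · have h : N - 2 ≤ n := by omega
      induction n, h using Int.leInduction with
      | base =>
        have := hN (N - 2 + 1) (by omega)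
        exact ⟨0, fun z => by simp, fun z _ => Subsingleton.elim _ _⟩
      | succ n h ih =>
        by_cases hn' : n + 1 < N
        · have := hN _ hn'
          exact step n ⟨0, fun z => by simp, fun z _ => Subsingleton.elim _ _⟩
        · exact step n (ih hn')
  exact fun n => key n (all n)

/-- Elements of `M ⊗ R/I`. -/
lemma tmul_one_eq_zero {R M : Type} [CommRing R] [AddCommGroup M] [Module R M] (I : Ideal R)
    (x : M) : TensorProduct.tmul R x (1 : R ⧸ I) = 0 ↔ x ∈ I • (⊤ : Submodule R M) := by
  rw [← Submodule.Quotient.mk_eq_zero, ← TensorProduct.quotTensorEquivQuotSMul_mk_one_tmul,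
    LinearEquiv.map_eq_zero_iff, ← LinearEquiv.map_eq_zero_iff (TensorProduct.comm R M (R ⧸ I))]
  rfl

lemma exists_tmul_one {R M : Type} [CommRing R] [AddCommGroup M] [Module R M] (I : Ideal R)
    (t : TensorProduct R M (R ⧸ I)) : ∃ x : M, t = TensorProduct.tmul R x (1 : R ⧸ I) := by
  induction t with
  | zero => exact ⟨0, by simp⟩
  | add a b ha hb =>
    obtain ⟨x, rfl⟩ := ha
    obtain ⟨y, rfl⟩ := hb
    exact ⟨x + y, by rw [TensorProduct.add_tmul]⟩
  | tmul x r =>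
    obtain ⟨r, rfl⟩ := Ideal.Quotient.mk_surjective r
    refine ⟨r • x, ?_⟩
    rw [TensorProduct.smul_tmul, Algebra.smul_def, mul_one]; rfl

lemma mem_smul_prod {R M N : Type} [CommRing R] [AddCommGroup M] [Module R M] [AddCommGroup N]
    [Module R N] (I : Ideal R) (x : M) (y : N) :
    (x, y) ∈ I • (⊤ : Submodule R (M × N)) ↔
      x ∈ I • (⊤ : Submodule R M) ∧ y ∈ I • (⊤ : Submodule R N) := by
  constructor
  · intro h
    constructor
    · have := Submodule.mem_map_of_mem (f := LinearMap.fst R M N) h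
      rw [Submodule.map_smul''] at this
      exact Submodule.smul_mono le_rfl le_top this
    · have := Submodule.mem_map_of_mem (f := LinearMap.snd R M N) h
      rw [Submodule.map_smul''] at this
      exact Submodule.smul_mono le_rfl le_top this
  · rintro ⟨hx, hy⟩
    have h1 := Submodule.mem_map_of_mem (f := LinearMap.inl R M N) hx
    have h2 := Submodule.mem_map_of_mem (f := LinearMap.inr R M N) hy
    rw [Submodule.map_smul''] at h1 h2
    have := add_mem (Submodule.smul_mono (le_refl I) le_top h1) (Submodule.smul_mono (le_refl I) le_top h2)
    simpa using this

lemma mod_of_coneExact {R : Type} [CommRing R] (I : Ideal R)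
    {C C' : ChainComplex (ModuleCat.{0} R) ℤ} (f : C ⟶ C')
    (h : ConeExact ((Functor.mapHomologicalComplex (tensorRight (ModuleCat.of R (R ⧸ I)))
        (ComplexShape.down ℤ)).map f))
    (i j k l : ℤ) (hj : j = i + 1) (hk : k = j + 1) (hl : l = k + 1) (x : C.X j) (y : C'.X k)
    (hx : (C.d j i).hom x ∈ I • (⊤ : Submodule R (C.X i)))
    (hxy : (f.f j).hom x - (C'.d k j).hom y ∈ I • (⊤ : Submodule R (C'.X j))) :
    ∃ (u : C.X k) (v : C'.X l), (C.d k j).hom u - x ∈ I • (⊤ : Submodule R (C.X j)) ∧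
      (f.f k).hom u - (C'.d l k).hom v - y ∈ I • (⊤ : Submodule R (C'.X k)) := by
  rw [← tmul_one_eq_zero] at hx hxy
  rw [TensorProduct.sub_tmul, sub_eq_zero] at hxy
  obtain ⟨u, v, hu, hv⟩ := h i j k l hj hk hl (TensorProduct.tmul R x (1 : R ⧸ I))
    (TensorProduct.tmul R y (1 : R ⧸ I)) hx hxy
  obtain ⟨u, rfl⟩ := exists_tmul_one I u
  obtain ⟨v, rfl⟩ := exists_tmul_one I v
  refine ⟨u, v, ?_, ?_⟩
  · rw [← tmul_one_eq_zero, TensorProduct.sub_tmul, sub_eq_zero]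
    exact hu
  · rw [← tmul_one_eq_zero, TensorProduct.sub_tmul, sub_eq_zero, TensorProduct.sub_tmul]
    exact hv

lemma span_X_le (F : Type) [Field F] (n : ℕ) :
    Ideal.span (Set.range (MvPowerSeries.X : Fin n → MvPowerSeries (Fin n) F)) ≤
      Ideal.jacobson ⊥ := by
  rw [IsLocalRing.jacobson_eq_maximalIdeal ⊥ bot_ne_top, Ideal.span_le]
  rintro _ ⟨i, rfl⟩
  rw [SetLike.mem_coe, IsLocalRing.mem_maximalIdeal, mem_nonunits_iff,
    MvPowerSeries.isUnit_iff_constantCoeff]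
  simp

lemma coneExact_of_mod {R : Type} [CommRing R] (I : Ideal R) (hI : I ≤ Ideal.jacobson ⊥)
    {C C' : ChainComplex (ModuleCat.{0} R) ℤ} (f : C ⟶ C')
    (hCfree : ∀ i, Module.Free R (C.X i)) (hCfin : ∀ i, Module.Finite R (C.X i))
    (hC'free : ∀ i, Module.Free R (C'.X i)) (hC'fin : ∀ i, Module.Finite R (C'.X i))
    (N : ℤ) (hN : ∀ n < N, Subsingleton (C.X n) ∧ Subsingleton (C'.X (n + 1)))
    (h : ConeExact ((Functor.mapHomologicalComplex (tensorRight (ModuleCat.of R (R ⧸ I)))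
        (ComplexShape.down ℤ)).map f)) : ConeExact f := by
  have main := exact_of_exact_mod I hI (fun n => C.X n × C'.X (n + 1))
    (fun n => LinearMap.prod ((C.d (n + 1) n).hom ∘ₗ LinearMap.fst R _ _)
      ((f.f (n + 1)).hom ∘ₗ LinearMap.fst R _ _ -
        (C'.d (n + 1 + 1) (n + 1)).hom ∘ₗ LinearMap.snd R _ _))
    (by
      rintro n ⟨x, y⟩
      ext
      · simp [d_d_elem]
      · simp [d_d_elem, comm_elem])
    N (fun n hn => by
      have := (hN n hn).1
      have := (hN n hn).2
      infer_instance)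
    (by
      rintro n ⟨x, y⟩ hz
      obtain ⟨hx, hy⟩ := (mem_smul_prod I _ _).1 hz
      obtain ⟨u, v, hu, hv⟩ := mod_of_coneExact I f h n (n + 1) (n + 1 + 1) (n + 1 + 1 + 1)
        rfl rfl rfl x y hx hy
      exact ⟨(u, v), (mem_smul_prod I _ _).2 ⟨hu, hv⟩⟩)
  rintro i _ _ _ rfl rfl rfl x y hx hxy
  obtain ⟨⟨u, v⟩, hw⟩ := main i (x, y) (Prod.ext hx (sub_eq_zero.2 hxy))
  exact ⟨u, v, congr(($hw).1), congr(($hw).2)⟩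

open CategoryTheory MonoidalCategory in
/-- Derived Nakayama: for bounded complexes of finitely generated free modules over
`R = F[[X₁,…,X_n]]`, a chain map which becomes a quasi-isomorphism after tensoring with
`F = R/(X₁,…,X_n)` is a quasi-isomorphism. -/
theorem stmt0 (F : Type) [Field F] (n : ℕ)
    (C C' : ChainComplex (ModuleCat (MvPowerSeries (Fin n) F)) ℤ)
    (hCfree : ∀ i, Module.Free (MvPowerSeries (Fin n) F) (C.X i))
    (hCfin : ∀ i, Module.Finite (MvPowerSeries (Fin n) F) (C.X i))
    (hC'free : ∀ i, Module.Free (MvPowerSeries (Fin n) F) (C'.X i))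
    (hC'fin : ∀ i, Module.Finite (MvPowerSeries (Fin n) F) (C'.X i))
    (hCbdd : ∃ N : ℕ, ∀ i : ℤ, (N : ℤ) < |i| → Subsingleton (C.X i))
    (hC'bdd : ∃ N : ℕ, ∀ i : ℤ, (N : ℤ) < |i| → Subsingleton (C'.X i))
    (f : C ⟶ C')
    (hf : QuasiIso ((Functor.mapHomologicalComplex
        (tensorRight (ModuleCat.of (MvPowerSeries (Fin n) F)
          (MvPowerSeries (Fin n) F ⧸
            Ideal.span (Set.range (MvPowerSeries.X : Fin n → MvPowerSeries (Fin n) F)))))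
        (ComplexShape.down ℤ)).map f)) :
    QuasiIso f := by
  obtain ⟨N, hN⟩ := hCbdd
  obtain ⟨N', hN'⟩ := hC'bdd
  rw [quasiIso_iff_coneExact] at hf ⊢
  refine coneExact_of_mod _ (span_X_le F n) f hCfree hCfin hC'free hC'fin (-N - N' - 1)
    (fun m hm => ⟨hN m ?_, hN' (m + 1) ?_⟩) hf
  · rw [abs_of_neg (by omega)]; omega
  · rw [abs_of_neg (by omega)]; omega
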